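/- Let ε ∈ (0,1) and let n be an integer satisfying ⌈(log(n)+1)²⌉ < ⌈n^ε⌉ ≤ n − 2⌈log(n)⌉. Then the proportion p̃(n,ε) of elements g of the alternating group A_n such that g has even order and g^{|g|/2} is an involution whose support has cardinality at most ⌈n^ε⌉ satisfies p̃(n,ε) > ε/96. -/

import Mathlib

/-- The proportion of elements `g` of the alternating group `Aₙ` such that `g` has even
order and `g^(|g|/2)` is an involution whose support has cardinality at most `⌈n^ε⌉`. -/
noncomputable def altPropn (n : ℕ) (ε : ℝ) : ℝ :=
  (Nat.card {g : alternatingGroup (Fin n) //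
      Even (orderOf g) ∧ orderOf (g ^ (orderOf g / 2)) = 2 ∧
      ((((g ^ (orderOf g / 2) : alternatingGroup (Fin n)) :
          Equiv.Perm (Fin n)).support.card : ℤ) ≤ ⌈(n : ℝ) ^ ε⌉)} : ℝ) /
    Nat.card (alternatingGroup (Fin n))

open Equiv.Perm in
theorem aux_card_even {α : Type*} [Fintype α] [DecidableEq α] (h : 2 ≤ Fintype.card α) :
    ((Finset.univ.filter (fun g : Equiv.Perm α => sign g = 1)).card : ℝ)
      = (Fintype.card α).factorial / 2 := by
  have : Nontrivial α := Fintype.one_lt_card_iff_nontrivial.mp h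
  have h1 := two_mul_nat_card_alternatingGroup (α := α)
  have h2 : Nat.card (alternatingGroup α)
      = (Finset.univ.filter (fun g : Equiv.Perm α => sign g = 1)).card := by
    rw [Nat.card_eq_fintype_card]
    exact Fintype.card_of_subtype _ (fun x => by simp [mem_alternatingGroup])
  rw [h2, Nat.card_eq_fintype_card, Fintype.card_perm] at h1
  have h3 : (2 : ℝ) * ((Finset.univ.filter (fun g : Equiv.Perm α => sign g = 1)).card : ℝ)
      = (Fintype.card α).factorial := by exact_mod_cast h1
  linarith

open Equiv.Perm in
theorem aux_card_even_le {α : Type*} [Fintype α] [DecidableEq α] :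
    ((Finset.univ.filter (fun g : Equiv.Perm α => sign g = 1)).card : ℝ)
      ≤ (Fintype.card α).factorial / 2 * (1 + if Fintype.card α ≤ 1 then 1 else 0) := by
  split_ifs with h
  · have : (Finset.univ.filter (fun g : Equiv.Perm α => sign g = 1)).card
        ≤ (Fintype.card α).factorial := by
      rw [← Fintype.card_perm]; exact Finset.card_le_univ _
    have : ((Finset.univ.filter (fun g : Equiv.Perm α => sign g = 1)).card : ℝ)
        ≤ (Fintype.card α).factorial := by exact_mod_cast this
    linarith
  · rw [aux_card_even (by omega)]; linarith

open Equiv.Perm in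
theorem aux_card_odd {α : Type*} [Fintype α] [DecidableEq α] (h : 2 ≤ Fintype.card α) :
    ((Finset.univ.filter (fun g : Equiv.Perm α => sign g = -1)).card : ℝ)
      = (Fintype.card α).factorial / 2 := by
  have h1 := aux_card_even h
  have h2 := Finset.card_filter_add_card_filter_not (s := (Finset.univ : Finset (Equiv.Perm α)))
    (fun g : Equiv.Perm α => sign g = 1)
  rw [Finset.card_univ, Fintype.card_perm] at h2
  have h3 : (Finset.univ.filter (fun g : Equiv.Perm α => ¬ sign g = 1))
      = Finset.univ.filter (fun g : Equiv.Perm α => sign g = -1) := by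
    ext g
    simp only [Finset.mem_filter, Finset.mem_univ, true_and]
    rcases Int.units_eq_one_or (sign g) with h | h <;> simp [h] 
  rw [h3] at h2
  have h4 : ((Finset.univ.filter (fun g : Equiv.Perm α => sign g = 1)).card : ℝ)
    + ((Finset.univ.filter (fun g : Equiv.Perm α => sign g = -1)).card : ℝ)
      = (Fintype.card α).factorial := by exact_mod_cast h2
  linarith

open Equiv.Perm in
theorem aux_card_cyc {α : Type*} [Fintype α] [DecidableEq α] (l : ℕ) (hl : 2 ≤ l)
    (h : l ≤ Fintype.card α) :
    ((Finset.univ.filter (fun g : Equiv.Perm α => g.cycleType = {l})).card : ℝ)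
      * (Fintype.card α - l).factorial = (Fintype.card α).factorial / l := by
  rw [card_of_cycleType_singleton hl h]
  have h1 := Nat.choose_mul_factorial_mul_factorial h
  have h2 := Nat.mul_factorial_pred (show l ≠ 0 by omega)
  have hl0 : (l : ℝ) ≠ 0 := by positivity
  rw [eq_div_iff hl0]
  rw [← h1, ← h2]
  push_cast
  ring

open Equiv.Perm in
theorem aux_card_compl {α : Type*} [Fintype α] [DecidableEq α] (c : Equiv.Perm α) :
    Fintype.card {x // x ∉ c.support} = Fintype.card α - c.support.card := by
  rw [Fintype.card_subtype_compl, Fintype.card_coe]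

open Equiv.Perm in
theorem aux_fiber {α : Type*} [Fintype α] [DecidableEq α] (c : Equiv.Perm α)
    (hs : sign c = -1) :
    (Finset.univ.filter (fun g : Equiv.Perm α => sign g = -1 ∧ c ∈ g.cycleFactorsFinset)).card
      ≤ (Finset.univ.filter (fun k : Equiv.Perm {x // x ∉ c.support} => sign k = 1)).card := by
  apply Finset.card_le_card_of_surjOn (fun k => ofSubtype k * c)
  intro g hg
  simp only [Finset.coe_filter, Finset.mem_univ, true_and, Set.mem_ofPred_eq] at hg
  obtain ⟨hg1, hg2⟩ := hg
  have hd := disjoint_mul_inv_of_mem_cycleFactorsFinset hg2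
  have : g * c⁻¹ ∈ (ofSubtype : Equiv.Perm {x // x ∉ c.support} →* Equiv.Perm α).range := by
    rw [mem_range_ofSubtype_iff]
    intro x hx
    have := Finset.disjoint_left.mp hd.disjoint_support hx
    simpa using this
  obtain ⟨k, hk⟩ := this
  refine ⟨k, ?_, ?_⟩
  · simp only [Finset.coe_filter, Finset.mem_univ, true_and, Set.mem_ofPred_eq]
    rw [← sign_ofSubtype, hk]
    simp [hg1, hs]
  · simp [hk]

open Equiv.Perm in
theorem aux_sign_cyc {α : Type*} [Fintype α] [DecidableEq α] (c : Equiv.Perm α) (l : ℕ)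
    (hl : Even l) (hc : c.cycleType = {l}) : sign c = -1 := by
  rw [sign_of_cycleType, hc]
  simp [pow_succ, hl.neg_one_pow]

theorem aux_supp_cyc {α : Type*} [Fintype α] [DecidableEq α] (c : Equiv.Perm α) (l : ℕ)
    (hc : c.cycleType = {l}) : c.support.card = l := by
  rw [← Equiv.Perm.sum_cycleType, hc]; simp

open Equiv.Perm in
theorem aux_B {α : Type*} [Fintype α] [DecidableEq α] (d : ℕ) (hd : 2 ≤ d) (hde : Even d)
    (hr : 2 ≤ Fintype.card α) :
    ((Fintype.card α).factorial : ℝ) / 2 *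
        (1 - ((∑ j ∈ Finset.Icc 1 (Fintype.card α / d), (1 / j : ℝ)) + 1) / d)
      ≤ ((Finset.univ.filter (fun g : Equiv.Perm α => sign g = -1 ∧
          ∀ p ∈ g.cycleType, ¬ d ∣ p)).card : ℝ) := by
  set r := Fintype.card α with hrdef
  have hd0 : (0 : ℝ) < d := by positivity
  -- split of odd permutations
  have h1 := Finset.card_filter_add_card_filter_not
    (s := (Finset.univ.filter (fun g : Equiv.Perm α => sign g = -1)))
    (fun g : Equiv.Perm α => ∀ p ∈ g.cycleType, ¬ d ∣ p)
  rw [Finset.filter_filter, Finset.filter_filter] at h1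
  have h1' : ((Finset.univ.filter (fun g : Equiv.Perm α => sign g = -1 ∧
          ∀ p ∈ g.cycleType, ¬ d ∣ p)).card : ℝ) + 
      ((Finset.univ.filter (fun g : Equiv.Perm α => sign g = -1 ∧
          ¬ ∀ p ∈ g.cycleType, ¬ d ∣ p)).card : ℝ) = (r.factorial : ℝ) / 2 := by
    rw [← aux_card_odd hr]; exact_mod_cast h1
  -- bad set
  have h2 : (Finset.univ.filter (fun g : Equiv.Perm α => sign g = -1 ∧
          ¬ ∀ p ∈ g.cycleType, ¬ d ∣ p)) ⊆
      (Finset.Icc 1 (r / d)).biUnion (fun j =>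
        (Finset.univ.filter (fun c : Equiv.Perm α => c.cycleType = {d * j})).biUnion (fun c =>
          Finset.univ.filter (fun g : Equiv.Perm α => sign g = -1 ∧
            c ∈ g.cycleFactorsFinset))) := by
    intro g hg
    simp only [Finset.mem_filter, Finset.mem_univ, true_and] at hg
    obtain ⟨hg1, hg2⟩ := hg
    push Not at hg2
    obtain ⟨p, hp, j, rfl⟩ := hg2
    have hp2 := two_le_of_mem_cycleType hp
    have hpr := le_card_support_of_mem_cycleType hp
    have hpr2 : d * j ≤ r := hpr.trans (Finset.card_le_univ _)
    rw [cycleType_def, Multiset.mem_map] at hp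
    obtain ⟨c, hc, hcc⟩ := hp
    simp only [Finset.mem_biUnion, Finset.mem_filter, Finset.mem_univ, true_and, Finset.mem_Icc]
    refine ⟨j, ⟨?_, ?_⟩, c, ?_, hg1, hc⟩
    · rcases Nat.eq_zero_or_pos j with h | h
      · subst h; simp at hp2
      · exact h
    · rw [Nat.le_div_iff_mul_le (by omega), mul_comm]; exact hpr2
    · have := (mem_cycleFactorsFinset_iff.mp hc).1
      rw [this.cycleType]; simpa using hcc
  have h3 : ((Finset.univ.filter (fun g : Equiv.Perm α => sign g = -1 ∧
          ¬ ∀ p ∈ g.cycleType, ¬ d ∣ p)).card : ℝ) ≤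
      ∑ j ∈ Finset.Icc 1 (r / d), (r.factorial : ℝ) / 2 / d *
        (1 / j + if j = r / d then 1 else 0) := by
    calc _ ≤ ((∑ j ∈ Finset.Icc 1 (r / d),
        ∑ c ∈ Finset.univ.filter (fun c : Equiv.Perm α => c.cycleType = {d * j}),
          (Finset.univ.filter (fun g : Equiv.Perm α => sign g = -1 ∧
            c ∈ g.cycleFactorsFinset)).card : ℕ) : ℝ) := by
          have := (Finset.card_le_card h2).trans (Finset.card_biUnion_le.trans
            (Finset.sum_le_sum (fun j _ => Finset.card_biUnion_le)))
          exact_mod_cast this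
      _ ≤ _ := by
          push_cast
          apply Finset.sum_le_sum
          intro j hj
          rw [Finset.mem_Icc, Nat.le_div_iff_mul_le (by omega), mul_comm] at hj
          obtain ⟨hj1, hj2⟩ := hj
          have hj0 : (0 : ℝ) < j := by positivity
          have hdj : 2 ≤ d * j := by nlinarith
          have key : ∀ c ∈ Finset.univ.filter (fun c : Equiv.Perm α => c.cycleType = {d * j}),
              ((Finset.univ.filter (fun g : Equiv.Perm α => sign g = -1 ∧
                c ∈ g.cycleFactorsFinset)).card : ℝ) ≤
              ((r - d * j).factorial : ℝ) / 2 * (1 + if r - d * j ≤ 1 then 1 else 0) := by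
            intro c hc
            simp only [Finset.mem_filter, Finset.mem_univ, true_and] at hc
            have h5 := aux_fiber c (aux_sign_cyc c _ (hde.mul_right _) hc)
            have h6 := aux_card_even_le (α := {x // x ∉ c.support})
            rw [aux_card_compl, aux_supp_cyc c _ hc] at h6
            refine le_trans ?_ h6
            exact_mod_cast h5
          refine (Finset.sum_le_card_nsmul _ _ _ key).trans ?_
          rw [nsmul_eq_mul]
          have h7 := aux_card_cyc (α := α) (d * j) hdj hj2
          rw [← hrdef] at h7
          have h8 : (1 + if r - d * j ≤ 1 then (1 : ℝ) else 0) ≤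
              1 + j * if j = r / d then 1 else 0 := by
            split_ifs with h9 h10 h10
            · have : (1 : ℝ) ≤ j := by exact_mod_cast hj1
              linarith
            · exfalso; apply h10
              symm
              apply Nat.div_eq_of_lt_le
              · rw [mul_comm]; exact hj2
              · nlinarith [show r ≤ d * j + 1 by omega]
            · linarith
            · linarith
          calc _ = (((Finset.univ.filter (fun g : Equiv.Perm α => g.cycleType = {d * j})).card : ℝ)
                * (r - d * j).factorial) / 2 * (1 + if r - d * j ≤ 1 then (1 : ℝ) else 0) := by
                ring
            _ = (r.factorial / (d * j : ℕ)) / 2 * (1 + if r - d * j ≤ 1 then (1 : ℝ) else 0) := by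
                rw [h7]
            _ ≤ (r.factorial / (d * j : ℕ)) / 2 * (1 + j * if j = r / d then 1 else 0) := by
                gcongr
            _ = _ := by
                push_cast
                field_simp
  have h4 : ∑ j ∈ Finset.Icc 1 (r / d), (r.factorial : ℝ) / 2 / d *
        (1 / j + if j = r / d then 1 else 0) ≤ (r.factorial : ℝ) / 2 / d *
        ((∑ j ∈ Finset.Icc 1 (r / d), (1 / j : ℝ)) + 1) := by
    rw [← Finset.mul_sum, Finset.sum_add_distrib]
    gcongr
    rw [Finset.sum_ite_eq' ]
    split_ifs <;> norm_num
  have h5 : (r.factorial : ℝ) / 2 *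
        (1 - ((∑ j ∈ Finset.Icc 1 (r / d), (1 / j : ℝ)) + 1) / d) = (r.factorial : ℝ) / 2 -
        (r.factorial : ℝ) / 2 / d * ((∑ j ∈ Finset.Icc 1 (r / d), (1 / j : ℝ)) + 1) := by
    field_simp
  linarith

open Equiv.Perm in
theorem aux_disj {α : Type*} [Fintype α] [DecidableEq α] (c : Equiv.Perm α)
    (h : Equiv.Perm {x // x ∉ c.support}) : Disjoint c (ofSubtype h) := by
  intro x
  by_cases hx : x ∈ c.support
  · right; exact ofSubtype_apply_of_not_mem _ (by simpa using hx)
  · left; simpa using hx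

open Equiv.Perm in
theorem aux_good {α : Type*} [Fintype α] [DecidableEq α] (a k m : ℕ) (ha : 1 ≤ a)
    (hm : 2 ^ a * k ≤ m) (c : Equiv.Perm α) (hc : c.cycleType = {2 ^ a * k})
    (h : Equiv.Perm α) (hd : Disjoint c h) (hs : sign h = -1)
    (hh : ∀ p ∈ h.cycleType, ¬ 2 ^ a ∣ p) :
    sign (c * h) = 1 ∧ Even (orderOf (c * h)) ∧
      orderOf ((c * h) ^ (orderOf (c * h) / 2)) = 2 ∧
      ((c * h) ^ (orderOf (c * h) / 2)).support.card ≤ m := by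
  have h2a : 2 ∣ 2 ^ a := dvd_pow_self 2 (by omega)
  have hct : (c * h).cycleType = {2 ^ a * k} + h.cycleType := by rw [hd.cycleType_mul, hc]
  have hdN : 2 ^ a ∣ orderOf (c * h) :=
    (Dvd.intro _ rfl).trans (dvd_of_mem_cycleType (n := 2 ^ a * k) (by rw [hct]; simp))
  have h2N : 2 ∣ orderOf (c * h) := h2a.trans hdN
  have hN0 : orderOf (c * h) ≠ 0 := (orderOf_pos _).ne'
  refine ⟨?_, even_iff_two_dvd.mpr h2N, orderOf_pow_orderOf_div hN0 h2N, ?_⟩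
  · rw [Equiv.Perm.sign_mul, hs, aux_sign_cyc c _ ((even_iff_two_dvd.mpr h2a).mul_right k) hc]; simp
  · have hpow : h ^ (orderOf (c * h) / 2) = 1 := by
      rw [← orderOf_dvd_iff_pow_eq_one, ← lcm_cycleType, Multiset.lcm_dvd]
      intro p hp
      have hpN : p ∣ orderOf (c * h) := dvd_of_mem_cycleType (by rw [hct]; simp [hp])
      obtain ⟨q, hq⟩ := hpN
      rcases Nat.even_or_odd q with ⟨q', hq'⟩ | hodd
      · refine ⟨q', ?_⟩
        rw [hq, hq', ← two_mul, mul_left_comm]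
        exact Nat.mul_div_cancel_left _ (by norm_num)
      · exfalso
        apply hh p hp
        rw [hq] at hdN
        exact Nat.Coprime.dvd_of_dvd_mul_right
          (Nat.Coprime.pow_left _ (Nat.coprime_two_left.mpr hodd)) hdN
    rw [hd.commute.mul_pow, hpow, mul_one]
    refine (Finset.card_le_card (support_pow_le c _)).trans ?_
    rw [aux_supp_cyc c _ hc]; exact hm

open Equiv.Perm in
theorem aux_count (n a m : ℕ) (ha : 1 ≤ a) (hmn : m + 2 ≤ n) :
    ((n.factorial : ℝ) / 2) * ((∑ k ∈ Finset.Icc 1 (m / 2 ^ a), (1 / k : ℝ)) / (2 ^ a : ℕ)) *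
      (1 - ((∑ j ∈ Finset.Icc 1 (n / 2 ^ a), (1 / j : ℝ)) + 1) / (2 ^ a : ℕ)) ≤
    ((Finset.univ.filter (fun g : Equiv.Perm (Fin n) => sign g = 1 ∧ Even (orderOf g) ∧
      orderOf (g ^ (orderOf g / 2)) = 2 ∧
      (g ^ (orderOf g / 2)).support.card ≤ m)).card : ℝ) := by
  have hd2 : 2 ≤ 2 ^ a := by
    calc 2 = 2 ^ 1 := by norm_num
      _ ≤ 2 ^ a := Nat.pow_le_pow_right (by norm_num) ha
  have hde : Even (2 ^ a) := (Nat.even_pow.mpr ⟨by norm_num, by omega⟩)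
  set C := (Finset.Icc 1 (m / 2 ^ a)).biUnion (fun k =>
    Finset.univ.filter (fun c : Equiv.Perm (Fin n) => c.cycleType = {2 ^ a * k})) with hC
  have hCmem : ∀ c ∈ C, ∃ k, 2 ^ a * k ≤ m ∧ c.cycleType = {2 ^ a * k} := by
    intro c hc
    simp only [hC, Finset.mem_biUnion, Finset.mem_filter, Finset.mem_univ, true_and,
      Finset.mem_Icc] at hc
    obtain ⟨k, ⟨_, hk⟩, hck⟩ := hc
    rw [Nat.le_div_iff_mul_le (by omega), mul_comm] at hk
    exact ⟨k, hk, hck⟩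
  set B : (c : Equiv.Perm (Fin n)) → Finset (Equiv.Perm {x // x ∉ c.support}) := fun c =>
    Finset.univ.filter (fun g => sign g = -1 ∧ ∀ p ∈ g.cycleType, ¬ 2 ^ a ∣ p) with hB
  have hinj : (C.sigma B).card ≤ (Finset.univ.filter (fun g : Equiv.Perm (Fin n) =>
      sign g = 1 ∧ Even (orderOf g) ∧ orderOf (g ^ (orderOf g / 2)) = 2 ∧
      (g ^ (orderOf g / 2)).support.card ≤ m)).card := by
    apply Finset.card_le_card_of_injOn (fun x => x.1 * ofSubtype x.2)
    · rintro ⟨c, h⟩ hx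
      simp only [Finset.coe_sigma, Set.mem_sigma_iff, Finset.mem_coe, hB, Finset.mem_filter,
        Finset.mem_univ, true_and] at hx
      obtain ⟨hcC, hs, hh⟩ := hx
      obtain ⟨k, hk, hck⟩ := hCmem c hcC
      simp only [Finset.coe_filter, Finset.mem_univ, true_and, Set.mem_ofPred_eq]
      exact aux_good a k m ha hk c hck _ (aux_disj c h) (by rw [sign_ofSubtype, hs])
        (by rw [cycleType_ofSubtype]; exact hh)
    · rintro ⟨c, h⟩ hx ⟨c', h'⟩ hx' heq
      simp only [Finset.coe_sigma, Set.mem_sigma_iff, Finset.mem_coe, hB, Finset.mem_filter,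
        Finset.mem_univ, true_and] at hx hx' heq
      obtain ⟨hcC, hs, hh⟩ := hx
      obtain ⟨hcC', hs', hh'⟩ := hx'
      obtain ⟨k, hk, hck⟩ := hCmem c hcC
      obtain ⟨k', hk', hck'⟩ := hCmem c' hcC'
      have hcyc : c.IsCycle := by rw [← card_cycleType_eq_one, hck]; simp
      have hcyc' : c'.IsCycle := by rw [← card_cycleType_eq_one, hck']; simp
      have e1 := (aux_disj c h).cycleFactorsFinset_mul_eq_union
      have e2 := (aux_disj c' h').cycleFactorsFinset_mul_eq_union
      rw [← heq, e1, hcyc.cycleFactorsFinset_eq_singleton,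
        hcyc'.cycleFactorsFinset_eq_singleton] at e2
      have hmem : c' ∈ {c} ∪ (ofSubtype h).cycleFactorsFinset := by rw [e2]; simp
      have hcc : c' = c := by
        rcases Finset.mem_union.mp hmem with h1 | h1
        · simpa using h1
        · exfalso
          apply hh (2 ^ a * k') _ (Dvd.intro _ rfl)
          rw [← cycleType_ofSubtype, cycleType_def, Multiset.mem_map]
          exact ⟨c', h1, aux_supp_cyc c' _ hck'⟩
      subst hcc
      have : h = h' := ofSubtype_injective (mul_left_cancel heq)
      rw [this]
  rw [Finset.card_sigma] at hinj
  have hinj' : (∑ c ∈ C, ((B c).card : ℝ)) ≤ ((Finset.univ.filter (fun g : Equiv.Perm (Fin n) =>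
      sign g = 1 ∧ Even (orderOf g) ∧ orderOf (g ^ (orderOf g / 2)) = 2 ∧
      (g ^ (orderOf g / 2)).support.card ≤ m)).card : ℝ) := by exact_mod_cast hinj
  refine le_trans ?_ hinj'
  rw [hC, Finset.sum_biUnion]
  · rw [Finset.sum_div, Finset.mul_sum, Finset.sum_mul]
    apply Finset.sum_le_sum
    intro k hk
    rw [Finset.mem_Icc, Nat.le_div_iff_mul_le (by omega), mul_comm] at hk
    obtain ⟨hk1, hk2⟩ := hk
    have key : ∀ c ∈ Finset.univ.filter
        (fun c : Equiv.Perm (Fin n) => c.cycleType = {2 ^ a * k}),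
        ((n - 2 ^ a * k).factorial : ℝ) / 2 * 
          (1 - ((∑ j ∈ Finset.Icc 1 (n / 2 ^ a), (1 / j : ℝ)) + 1) / (2 ^ a : ℕ))
          ≤ ((B c).card : ℝ) := by
      intro c hc
      simp only [Finset.mem_filter, Finset.mem_univ, true_and] at hc
      have hcard : Fintype.card {x // x ∉ c.support} = n - 2 ^ a * k := by
        rw [aux_card_compl, aux_supp_cyc c _ hc, Fintype.card_fin]
      have := aux_B (α := {x // x ∉ c.support}) (2 ^ a) hd2 hde (by rw [hcard]; omega)
      refine le_trans ?_ this
      rw [hcard]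
      gcongr
      omega
    refine le_trans ?_ (Finset.card_nsmul_le_sum _ _ _ key)
    rw [nsmul_eq_mul]
    have h7 := aux_card_cyc (α := Fin n) (2 ^ a * k) (by nlinarith) (by simp; omega)
    rw [Fintype.card_fin] at h7
    apply le_of_eq
    rw [← mul_assoc, ← mul_div_assoc (Nat.cast _) ((n - 2 ^ a * k).factorial : ℝ) 2, h7]
    push_cast
    have : (k : ℝ) ≠ 0 := by positivity
    field_simp
  · intro k _ k' _ hne
    rw [Function.onFun, Finset.disjoint_left]
    intro c hc hc'
    simp only [Finset.mem_filter, Finset.mem_univ, true_and] at hc hc'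
    rw [hc, Multiset.singleton_inj] at hc'
    exact hne (Nat.eq_of_mul_eq_mul_left (by omega) hc')
theorem aux_harm (n : ℕ) : (∑ j ∈ Finset.Icc 1 n, (1 / j : ℝ)) = (harmonic n : ℝ) := by
  rw [harmonic_eq_sum_Icc]; push_cast; simp

theorem aux_log (n : ℕ) (h0 : 2 ≤ n)
    (h : Real.log n ^ 2 + 4 * Real.log n + 2 ≤ n) : 3 ≤ Real.log n := by
  have hn0 : (0 : ℝ) < n := by positivity
  have he := Real.exp_one_lt_d9
  have he0 := Real.exp_pos 1
  have hx0 : 0 < Real.log n := Real.log_pos (by exact_mod_cast h0)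
  have n3 : 3 ≤ n := by
    have : (2 : ℝ) < n := by nlinarith
    exact_mod_cast this
  have x1 : 1 ≤ Real.log n := by
    rw [Real.le_log_iff_exp_le hn0]
    have : (3 : ℝ) ≤ n := by exact_mod_cast n3
    linarith
  have n7 : (7 : ℝ) ≤ n := by nlinarith
  have e1 : Real.exp (3 / 2) ≤ 7 := by
    have : Real.exp (3 / 2) ^ 2 = Real.exp 1 ^ 3 := by
      rw [← Real.exp_nat_mul, ← Real.exp_nat_mul]; norm_num
    have h3 : Real.exp 1 ^ 3 ≤ 2.7182818286 ^ 3 := by gcongr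
    exact le_of_pow_le_pow_left₀ (n := 2) (by norm_num) (by norm_num)
      (by rw [this]; refine h3.trans (by norm_num))
  have x2 : 3 / 2 ≤ Real.log n := by
    rw [Real.le_log_iff_exp_le hn0]; linarith
  have n10 : (10 : ℝ) ≤ n := by nlinarith
  have e2 : Real.exp 2 ≤ 10 := by
    have : Real.exp 2 = Real.exp 1 ^ 2 := by
      rw [← Real.exp_nat_mul]; norm_num
    have h3 : Real.exp 1 ^ 2 ≤ 2.7182818286 ^ 2 := by gcongr
    rw [this]; refine h3.trans (by norm_num)
  have x3 : 2 ≤ Real.log n := by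
    rw [Real.le_log_iff_exp_le hn0]; linarith
  have n14 : (14 : ℝ) ≤ n := by nlinarith
  have e3 : Real.exp (5 / 2) ≤ 14 := by
    have : Real.exp (5 / 2) ^ 2 = Real.exp 1 ^ 5 := by
      rw [← Real.exp_nat_mul, ← Real.exp_nat_mul]; norm_num
    have h3 : Real.exp 1 ^ 5 ≤ 2.7182818286 ^ 5 := by gcongr
    exact le_of_pow_le_pow_left₀ (n := 2) (by norm_num) (by norm_num)
      (by rw [this]; refine h3.trans (by norm_num))
  have x4 : 5 / 2 ≤ Real.log n := by
    rw [Real.le_log_iff_exp_le hn0]; linarith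
  have n18 : (18.25 : ℝ) ≤ n := by nlinarith
  have e4 : Real.exp (29 / 10) ≤ 18.25 := by
    have : Real.exp (29 / 10) ^ 10 = Real.exp 1 ^ 29 := by
      rw [← Real.exp_nat_mul, ← Real.exp_nat_mul]; norm_num
    have h3 : Real.exp 1 ^ 29 ≤ 2.7182818286 ^ 29 := by gcongr
    exact le_of_pow_le_pow_left₀ (n := 10) (by norm_num) (by norm_num)
      (by rw [this]; refine h3.trans (by norm_num))
  have x5 : 29 / 10 ≤ Real.log n := by
    rw [Real.le_log_iff_exp_le hn0]; linarith
  have n22 : (22 : ℝ) ≤ n := by nlinarith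
  rw [Real.le_log_iff_exp_le hn0]
  have : Real.exp 3 = Real.exp 1 ^ 3 := by
    rw [← Real.exp_nat_mul]; norm_num
  have h3 : Real.exp 1 ^ 3 ≤ 2.7182818286 ^ 3 := by gcongr
  rw [this]
  refine h3.trans (le_trans (by norm_num) n22)

theorem aux_prop (n : ℕ) (ε : ℝ) (m : ℕ) (hm : (m : ℤ) = ⌈(n : ℝ) ^ ε⌉) (hn : 2 ≤ n) :
    altPropn n ε = ((Finset.univ.filter (fun g : Equiv.Perm (Fin n) => Equiv.Perm.sign g = 1 ∧
      Even (orderOf g) ∧ orderOf (g ^ (orderOf g / 2)) = 2 ∧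
      (g ^ (orderOf g / 2)).support.card ≤ m)).card : ℝ) / ((n.factorial : ℝ) / 2) := by
  unfold altPropn
  have hA : (Nat.card (alternatingGroup (Fin n)) : ℝ) = (n.factorial : ℝ) / 2 := by
    have : Nontrivial (Fin n) := Fin.nontrivial_iff_two_le.mpr hn
    have h1 := two_mul_nat_card_alternatingGroup (α := Fin n)
    rw [Nat.card_eq_fintype_card (α := Equiv.Perm (Fin n)), Fintype.card_perm,
      Fintype.card_fin] at h1
    have : (2 : ℝ) * (Nat.card (alternatingGroup (Fin n)) : ℝ) = n.factorial := by
      exact_mod_cast h1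
    linarith
  rw [hA]
  congr 2
  rw [← hm]
  rw [← Fintype.card_coe, ← Nat.card_eq_fintype_card]
  apply Nat.card_congr
  refine ⟨fun x => ⟨x.1.1, ?_⟩, fun y => ⟨⟨y.1, ?_⟩, ?_⟩, fun x => ?_, fun y => ?_⟩
  · obtain ⟨⟨g, hg⟩, h1, h2, h3⟩ := x
    simp only [← Subgroup.orderOf_coe, SubmonoidClass.coe_pow] at h1 h2 h3
    simp only [Finset.mem_filter, Finset.mem_univ, true_and]
    refine ⟨hg, h1, h2, ?_⟩
    exact_mod_cast h3
  · have := y.2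
    simp only [Finset.mem_filter, Finset.mem_univ, true_and] at this
    exact this.1
  · obtain ⟨g, hg⟩ := y
    simp only [Finset.mem_filter, Finset.mem_univ, true_and] at hg
    obtain ⟨h0, h1, h2, h3⟩ := hg
    simp only [← Subgroup.orderOf_coe, SubmonoidClass.coe_pow]
    refine ⟨h1, h2, ?_⟩
    exact_mod_cast h3
  · rfl
  · rfl

theorem stmt1 (ε : ℝ) (hε : ε ∈ Set.Ioo (0 : ℝ) 1) (n : ℕ)
    (h1 : ⌈(Real.log n + 1) ^ 2⌉ < ⌈(n : ℝ) ^ ε⌉)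
    (h2 : ⌈(n : ℝ) ^ ε⌉ ≤ (n : ℤ) - 2 * ⌈Real.log n⌉) :
    altPropn n ε > ε / 96 := by
  obtain ⟨hε0, hε1⟩ := hε
  have hn2 : 2 ≤ n := by
    by_contra hcon
    have : n = 0 ∨ n = 1 := by omega
    rcases this with rfl | rfl
    · simp [Real.zero_rpow hε0.ne'] at h1
    · simp at h1
  have hn0 : (0 : ℝ) < n := by positivity
  set x := Real.log n with hx
  have hx0 : 0 < x := Real.log_pos (by exact_mod_cast hn2)
  obtain ⟨m, hm⟩ : ∃ m : ℕ, (m : ℤ) = ⌈(n : ℝ) ^ ε⌉ :=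
    ⟨⌈(n : ℝ) ^ ε⌉.toNat, Int.toNat_of_nonneg (Int.ceil_nonneg (by positivity))⟩
  have hle : (n : ℝ) ^ ε ≤ m := by
    have := Int.le_ceil ((n : ℝ) ^ ε)
    rw [← hm] at this; exact_mod_cast this
  rw [← hm] at h1 h2
  have hm1 : (x + 1) ^ 2 + 1 ≤ m := by
    have h3 := Int.le_ceil ((x + 1) ^ 2)
    have h4 : ((⌈(x + 1) ^ 2⌉ : ℤ) : ℝ) + 1 ≤ m := by exact_mod_cast h1
    linarith
  have hc1 : 1 ≤ ⌈x⌉ := Int.one_le_ceil_iff.mpr hx0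
  have hmn : m + 2 ≤ n := by omega
  have hm2 : (m : ℝ) + 2 * x ≤ n := by
    have h3 := Int.le_ceil x
    have h4 : (m : ℝ) ≤ n - 2 * (⌈x⌉ : ℤ) := by exact_mod_cast h2
    linarith
  have hx3 : 3 ≤ x := aux_log n hn2 (by rw [← hx]; nlinarith)
  have hm0 : (0 : ℝ) < m := by nlinarith
  -- choice of the power of two
  have hf0 : ⌊4 * (x + 1)⌋₊ ≠ 0 := by
    have : 1 ≤ ⌊4 * (x + 1)⌋₊ := Nat.le_floor (by push_cast; linarith)
    omega
  obtain ⟨a, ha1, ha2⟩ : ∃ a : ℕ, ((2 ^ a : ℕ) : ℝ) ≤ 4 * (x + 1) ∧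
      2 * (x + 1) < ((2 ^ a : ℕ) : ℝ) := by
    refine ⟨Nat.log 2 ⌊4 * (x + 1)⌋₊, ?_, ?_⟩
    · have h3 := Nat.pow_log_le_self 2 hf0
      have h4 := Nat.floor_le (show 0 ≤ 4 * (x + 1) by linarith)
      refine le_trans ?_ h4
      exact_mod_cast h3
    · have h3 := Nat.lt_pow_succ_log_self (b := 2) (by norm_num) ⌊4 * (x + 1)⌋₊
      have h4 := Nat.lt_floor_add_one (4 * (x + 1))
      have h5 : (⌊4 * (x + 1)⌋₊ : ℝ) + 1 ≤ 2 ^ (Nat.log 2 ⌊4 * (x + 1)⌋₊) * 2 := by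
        rw [pow_succ] at h3
        exact_mod_cast h3
      push_cast
      linarith
  have ha : 1 ≤ a := by
    rcases Nat.eq_zero_or_pos a with h | h
    · subst h; norm_num at ha2; linarith
    · exact h
  have hcount := aux_count n a m ha hmn
  rw [aux_prop n ε m hm hn2]
  rw [aux_harm, aux_harm] at hcount
  set d : ℕ := 2 ^ a with hd
  have hd0 : (0 : ℝ) < d := by linarith
  have hd8 : (8 : ℝ) < d := by linarith
  have hdm : (d : ℝ) ≤ m := by nlinarith
  have hdm' : d ≤ m := by exact_mod_cast hdm
  have hdpos : 0 < d := by exact_mod_cast hd0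
  -- the upper harmonic bound
  have hHn : (harmonic (n / d) : ℝ) ≤ x := by
    have h3 := harmonic_le_one_add_log (n / d)
    have hq : 1 ≤ n / d := by
      rw [Nat.le_div_iff_mul_le hdpos]; omega
    have h4 : ((n / d : ℕ) : ℝ) ≤ n / Real.exp 1 := by
      refine (Nat.cast_div_le).trans ?_
      have := Real.exp_one_lt_d9
      gcongr
      linarith
    have h5 := Real.log_le_log (by exact_mod_cast hq) h4
    rw [Real.log_div hn0.ne' (Real.exp_pos 1).ne', Real.log_exp] at h5
    linarith
  have hc : 1 / 2 ≤ 1 - ((harmonic (n / d) : ℝ) + 1) / d := by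
    have : ((harmonic (n / d) : ℝ) + 1) / d ≤ 1 / 2 := by
      rw [div_le_iff₀ hd0]; linarith
    linarith
  -- the lower harmonic bound
  have hH1 : 1 ≤ (harmonic (m / d) : ℝ) := by
    rw [← aux_harm]
    have hq : 1 ≤ m / d := by
      rw [Nat.le_div_iff_mul_le hdpos]; omega
    calc (1 : ℝ) = ∑ j ∈ ({1} : Finset ℕ), (1 / j : ℝ) := by simp
      _ ≤ _ := by
        apply Finset.sum_le_sum_of_subset_of_nonneg
        · intro i hi; simp at hi; simp [hi, hq]
        · intros; positivity
  have hH2 : Real.log m - Real.log d ≤ (harmonic (m / d) : ℝ) := by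
    have h3 := log_le_harmonic_floor ((m : ℝ) / d) (by positivity)
    rw [Real.log_div hm0.ne' hd0.ne', Nat.floor_div_eq_div] at h3
    exact h3
  have hlogd : Real.log d ≤ 2 * Real.log 2 + Real.log (x + 1) := by
    have h3 := Real.log_le_log hd0 ha1
    rw [Real.log_mul (by norm_num) (by linarith), show (4 : ℝ) = 2 ^ 2 by norm_num,
      Real.log_pow] at h3
    exact_mod_cast h3
  have hlogm : 2 * Real.log (x + 1) ≤ Real.log m := by
    have h3 := Real.log_le_log (by positivity) (show (x + 1) ^ 2 ≤ m by linarith)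
    rw [Real.log_pow] at h3
    exact_mod_cast h3
  have hl2 := Real.log_two_lt_d9
  have hH : Real.log m / 9 < (harmonic (m / d) : ℝ) := by
    rcases lt_or_ge (Real.log m) 9 with h | h
    · linarith
    · linarith
  have hεm : ε * x ≤ Real.log m := by
    have h3 := Real.log_le_log (by positivity) hle
    rwa [Real.log_rpow hn0] at h3
  set H := (harmonic (m / d) : ℝ) with hHdef
  have hfac : (0 : ℝ) < (n.factorial : ℝ) / 2 := by positivity
  rw [gt_iff_lt, lt_div_iff₀ hfac]
  refine lt_of_lt_of_le ?_ hcount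
  have hA : ε / 96 < H / d * (1 / 2) := by
    rw [div_mul_div_comm, div_lt_div_iff₀ (by norm_num) (by positivity)]
    have h3 : ε * (x + 1) ≤ 4 / 3 * Real.log m := by nlinarith
    have h4 : ε * d ≤ ε * (4 * (x + 1)) := by gcongr
    nlinarith
  calc ε / 96 * ((n.factorial : ℝ) / 2) < H / d * (1 / 2) * ((n.factorial : ℝ) / 2) := by
        gcongr
    _ = (n.factorial : ℝ) / 2 * (H / d) * (1 / 2) := by ring
    _ ≤ _ := by gcongr
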